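/- Let n ≥ 2 be an integer and ξ a real number with ŵ_n(ξ) > 2n−2 (such ξ is necessarily not algebraic of degree at most n, so the best approximation sequence is defined). Then ŵ_n(ξ) ≤ limsup_{k→∞} τ_k + 2n−3. -/

import Mathlib

open Polynomial Filter

noncomputable section

/-- Height of an integer polynomial: maximum absolute value of its coefficients. -/
def polyHeight (P : Polynomial ℤ) : ℕ :=
  P.support.sup fun i => (P.coeff i).natAbs

/-- The set of exponents `w` admissible for the uniform exponent `ŵ_n(ξ)`. -/
def uniformExpSet (n : ℕ) (ξ : ℝ) : Set ℝ :=
  {w | ∀ᶠ X : ℝ in atTop, ∃ P : Polynomial ℤ, P.natDegree ≤ n ∧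
    (polyHeight P : ℝ) ≤ X ∧ 0 < |Polynomial.aeval ξ P| ∧
    |Polynomial.aeval ξ P| < X ^ (-w)}

/-- The uniform exponent `ŵ_n(ξ)`, as an extended real. -/
def wHat (n : ℕ) (ξ : ℝ) : EReal :=
  sSup ((fun w : ℝ => (w : EReal)) '' uniformExpSet n ξ)

/-- The set of exponents `w` admissible for the ordinary exponent `w_n(ξ)`. -/
def ordExpSet (n : ℕ) (ξ : ℝ) : Set ℝ :=
  {w | {P : Polynomial ℤ | P.natDegree ≤ n ∧ 0 < |Polynomial.aeval ξ P| ∧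
      |Polynomial.aeval ξ P| < (polyHeight P : ℝ) ^ (-w)}.Infinite}

/-- The ordinary exponent `w_n(ξ)`, as an extended real. -/
def wOrd (n : ℕ) (ξ : ℝ) : EReal :=
  sSup ((fun w : ℝ => (w : EReal)) '' ordExpSet n ξ)

/-- `P` (1-indexed: the relevant values are `P 1, P 2, …`) is the sequence of best
approximation polynomials associated to `(n, ξ)`. -/
structure IsBestApproxSeq (n : ℕ) (ξ : ℝ) (P : ℕ → Polynomial ℤ) : Prop where
  ne_zero : ∀ k, 1 ≤ k → P k ≠ 0
  deg_le : ∀ k, 1 ≤ k → (P k).natDegree ≤ n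
  height_lt : ∀ k, 1 ≤ k → polyHeight (P k) < polyHeight (P (k+1))
  eval_lt : ∀ k, 1 ≤ k → |Polynomial.aeval ξ (P (k+1))| < |Polynomial.aeval ξ (P k)|
  isMin : ∀ k, 1 ≤ k → ∀ Q : Polynomial ℤ, Q ≠ 0 → Q.natDegree ≤ n →
    polyHeight Q ≤ polyHeight (P k) →
    |Polynomial.aeval ξ (P k)| ≤ |Polynomial.aeval ξ Q|
  complete : ∀ Q : Polynomial ℤ, Q ≠ 0 → Q.natDegree ≤ n →
    (∀ R : Polynomial ℤ, R ≠ 0 → R.natDegree ≤ n → polyHeight R ≤ polyHeight Q →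
      |Polynomial.aeval ξ Q| ≤ |Polynomial.aeval ξ R|) →
    ∃ k, 1 ≤ k ∧ (Q = P k ∨ Q = -P k)

/-- The image of an integer polynomial in `ℚ[X]`. -/
def ratPoly (P : Polynomial ℤ) : Polynomial ℚ := P.map (Int.castRingHom ℚ)

/-- `k` is good for the sequence `P`: `P_{k-1}, P_k, P_{k+1}` are `ℚ`-linearly independent. -/
def Good (P : ℕ → Polynomial ℤ) (k : ℕ) : Prop :=
  LinearIndependent ℚ ![ratPoly (P (k-1)), ratPoly (P k), ratPoly (P (k+1))]

/-- `τ_k = log H_k / log H_{k-1}`. -/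
def tauk (P : ℕ → Polynomial ℤ) (k : ℕ) : ℝ :=
  Real.log (polyHeight (P k)) / Real.log (polyHeight (P (k-1)))

/-- `μ_k = -log |P_{k-1}(ξ)| / log H_k`. -/
def muk (ξ : ℝ) (P : ℕ → Polynomial ℤ) (k : ℕ) : ℝ :=
  - Real.log |Polynomial.aeval ξ (P (k-1))| / Real.log (polyHeight (P k))

/-- `v_k = -log |P_k(ξ)| / log H_k`. -/
def vk (ξ : ℝ) (P : ℕ → Polynomial ℤ) (k : ℕ) : ℝ :=
  - Real.log |Polynomial.aeval ξ (P k)| / Real.log (polyHeight (P k))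

/-- The set of integers `m ≥ k+1` such that `P_{k-1}, …, P_{m-1}` all lie in the
two-dimensional space spanned by `P_{k-1}` and `P_k`; its greatest element is `ℓ(k)`. -/
def ellSet (P : ℕ → Polynomial ℤ) (k : ℕ) : Set ℕ :=
  {m | k + 1 ≤ m ∧ ∀ j, k - 1 ≤ j → j ≤ m - 1 →
    ratPoly (P j) ∈ Submodule.span ℚ {ratPoly (P (k-1)), ratPoly (P k)}}

/-- The set `V_k = {P, T·P, …, T^{n-2}·P}` (as rational polynomials). -/
def Vset (n : ℕ) (A : Polynomial ℤ) : Set (Polynomial ℚ) :=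
  {q | ∃ i ≤ n - 2, q = Polynomial.X ^ i * ratPoly A}

/-- The trajectory `L_P(q) = max(log H(P) - q/(2n-2), log |P(ξ)| + q)`. -/
def LPtraj (n : ℕ) (ξ : ℝ) (Q : Polynomial ℤ) (q : ℝ) : ℝ :=
  max (Real.log (polyHeight Q) - q / (2*(n:ℝ)-2)) (Real.log |Polynomial.aeval ξ Q| + q)

/-- The `j`-th successive minimum function `L_j(q)`: the infimum over sets of `j`
linearly independent integer polynomials of degree at most `2n-2` of the maximum of
`L_P(q)` over the set. -/
def Lj (n : ℕ) (ξ : ℝ) (j : ℕ) (q : ℝ) : ℝ :=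
  sInf {y : ℝ | ∃ S : Finset (Polynomial ℤ), S.card = j ∧
    (∀ Q ∈ S, Q.natDegree ≤ 2*n-2) ∧
    LinearIndependent ℚ (fun Q : {x // x ∈ S} => ratPoly (Q : Polynomial ℤ)) ∧
    y = sSup ((fun Q => LPtraj n ξ Q q) '' (S : Set (Polynomial ℤ)))}

/-! ### Heights and Mahler measures -/

lemma natAbs_coeff_le_polyHeight (Q : ℤ[X]) (i : ℕ) : (Q.coeff i).natAbs ≤ polyHeight Q := by
  by_cases h : i ∈ Q.support
  · exact Finset.le_sup (f := fun i => (Q.coeff i).natAbs) h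
  · simp [notMem_support_iff.mp h]

lemma abs_coeff_le_polyHeight (Q : ℤ[X]) (i : ℕ) : |(Q.coeff i : ℝ)| ≤ polyHeight Q := by
  have := natAbs_coeff_le_polyHeight Q i
  rw [← Int.cast_abs, Int.abs_eq_natAbs]
  exact_mod_cast this

lemma polyHeight_le {Q : ℤ[X]} {B : ℕ} (h : ∀ i, (Q.coeff i).natAbs ≤ B) : polyHeight Q ≤ B :=
  Finset.sup_le fun i _ => h i

lemma polyHeight_X_pow_mul_le (Q : ℤ[X]) (i : ℕ) : polyHeight (X ^ i * Q) ≤ polyHeight Q := by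
  refine polyHeight_le fun j => ?_
  rw [coeff_X_pow_mul']
  split_ifs
  · exact natAbs_coeff_le_polyHeight _ _
  · simp

lemma one_le_polyHeight {Q : ℤ[X]} (hQ : Q ≠ 0) : 1 ≤ polyHeight Q := by
  refine le_trans ?_ (natAbs_coeff_le_polyHeight Q Q.natDegree)
  have : Q.leadingCoeff ≠ 0 := by simpa using hQ
  exact Int.natAbs_pos.mpr this

/-- The Mahler measure of an integer polynomial. -/
def intMahler (Q : ℤ[X]) : ℝ := (Q.map (Int.castRingHom ℂ)).mahlerMeasure

lemma intMahler_mul (Q R : ℤ[X]) : intMahler (Q * R) = intMahler Q * intMahler R := by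
  simp [intMahler, mahlerMeasure_mul]

lemma one_le_intMahler {Q : ℤ[X]} (hQ : Q ≠ 0) : 1 ≤ intMahler Q :=
  one_le_mahlerMeasure_of_ne_zero hQ

lemma intMahler_le {n : ℕ} {Q : ℤ[X]} (hQ : Q.natDegree ≤ n) :
    intMahler Q ≤ (n + 1) * polyHeight Q := by
  refine (mahlerMeasure_le_sum_norm_coeff _).trans ?_
  rw [sum_over_range' _ (by simp) (n + 1) ((natDegree_map_le).trans_lt (by omega))]
  refine (Finset.sum_le_card_nsmul _ _ (polyHeight Q : ℝ) fun i _ => ?_).trans (by simp)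
  simpa using abs_coeff_le_polyHeight Q i

lemma polyHeight_le_intMahler {n : ℕ} {Q : ℤ[X]} (hQ : Q.natDegree ≤ n) :
    (polyHeight Q : ℝ) ≤ 2 ^ n * intMahler Q := by
  have h0 : 0 ≤ intMahler Q := mahlerMeasure_nonneg _
  have key : ∀ i, |(Q.coeff i : ℝ)| ≤ 2 ^ n * intMahler Q := fun i => by
    have h := norm_coeff_le_choose_mul_mahlerMeasure i (Q.map (Int.castRingHom ℂ))
    have h2 : ((Q.map (Int.castRingHom ℂ)).natDegree.choose i : ℝ) ≤ 2 ^ n := by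
      have : (Q.map (Int.castRingHom ℂ)).natDegree.choose i ≤ 2 ^ n :=
        (Nat.choose_le_two_pow _ _).trans
          (Nat.pow_le_pow_right (by norm_num) (natDegree_map_le.trans hQ))
      exact_mod_cast this
    rw [coeff_map] at h
    simp only [eq_intCast, Complex.norm_intCast] at h
    exact h.trans (mul_le_mul_of_nonneg_right h2 h0)
  have h1 : polyHeight Q ≤ ⌊2 ^ n * intMahler Q⌋₊ := polyHeight_le fun i => by
    refine Nat.le_floor ?_
    rw [Nat.cast_natAbs, Int.cast_abs]
    exact key i
  exact (Nat.cast_le.mpr h1).trans (Nat.floor_le (by positivity))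

lemma finite_polyHeight_le (n B : ℕ) : {Q : ℤ[X] | Q.natDegree ≤ n ∧ polyHeight Q ≤ B}.Finite := by
  refine (finite_mahlerMeasure_le n (((n + 1) * B : ℕ) : NNReal)).subset fun Q ⟨h1, h2⟩ => ⟨h1, ?_⟩
  refine (intMahler_le h1).trans ?_
  push_cast
  gcongr

/-! ### The determinant inequality -/

/-- If `F` is a linearly independent family of as many integer polynomials as the dimension of the
ambient space, its determinant is at least `1`, so not all values at `ξ` can be small. -/
theorem one_le_of_linearIndependent {ι : Type*} [Fintype ι] [Nonempty ι] (ξ : ℝ)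
    (F : ι → ℤ[X]) (hdeg : ∀ i, (F i).natDegree < Fintype.card ι)
    (hli : LinearIndependent ℚ fun i => ratPoly (F i)) (h : ι → ℝ) (ε : ℝ)
    (hH : ∀ i, (polyHeight (F i) : ℝ) ≤ h i) (hε : ∀ i, |aeval ξ (F i)| ≤ ε * h i) :
    1 ≤ (Fintype.card ι).factorial * (ε * ∏ i, h i) := by
  classical
  set N := Fintype.card ι with hN
  have hN0 : 0 < N := Fintype.card_pos
  let e : ι ≃ Fin N := Fintype.equivFin ι
  let A : Matrix ι ι ℤ := fun i j => (F i).coeff (e j)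
  have hdet : A.det ≠ 0 := by
    intro h0
    obtain ⟨v, hv, hvA⟩ := Matrix.exists_vecMul_eq_zero_iff.mpr h0
    apply hv
    have := Fintype.linearIndependent_iff.mp hli (fun i => (v i : ℚ)) (by
      ext m
      simp only [finsetSum_coeff, coeff_smul, smul_eq_mul, coeff_zero, ratPoly, coeff_map,
        eq_intCast]
      by_cases hm : m < N
      · have := congrFun hvA (e.symm ⟨m, hm⟩)
        simp only [Matrix.vecMul, dotProduct, A, Equiv.apply_symm_apply, Pi.zero_apply] at this
        exact_mod_cast this
      · refine Finset.sum_eq_zero fun i _ => ?_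
        rw [coeff_eq_zero_of_natDegree_lt ((hdeg i).trans_le (not_lt.mp hm))]
        simp)
    funext i
    exact_mod_cast this i
  let j₀ : ι := e.symm ⟨0, hN0⟩
  let B : Matrix ι ι ℝ := A.map (Int.castRingHom ℝ)
  have hB : B.det = (A.det : ℝ) := by
    simp only [B]
    rw [← RingHom.mapMatrix_apply, ← RingHom.map_det]; simp
  have hcol : (B.updateCol j₀ fun i => aeval ξ (F i)).det = B.det := by
    have := Matrix.det_updateCol_sum B j₀ fun j => ξ ^ (e j : ℕ)
    simp only [j₀, Equiv.apply_symm_apply, pow_zero, one_smul] at this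
    rw [← this]
    congr 2
    funext i
    rw [aeval_eq_sum_range' (hdeg i), ← Fin.sum_univ_eq_sum_range, ← e.sum_comp]
    refine Finset.sum_congr rfl fun j _ => ?_
    rw [show B i j = ((F i).coeff (e j) : ℝ) from rfl]
    simp [mul_comm]
  have h1 : (1 : ℝ) ≤ |B.det| := by
    rw [hB]; exact_mod_cast Int.one_le_abs hdet
  refine h1.trans ?_
  rw [← hcol, Matrix.det_apply]
  refine (Finset.abs_sum_le_sum_abs _ _).trans ?_
  refine (Finset.sum_le_card_nsmul _ _ (ε * ∏ i, h i) fun σ _ => ?_).trans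
    (by simp [Fintype.card_perm, hN])
  have hs : ∀ x : ℝ, |Equiv.Perm.sign σ • x| = |x| := fun x => by
    rcases Int.units_eq_one_or (Equiv.Perm.sign σ) with h | h <;> simp [h]
  rw [hs, Finset.abs_prod, ← Finset.mul_prod_erase _ _ (Finset.mem_univ j₀),
    ← Equiv.prod_comp σ h, ← Finset.mul_prod_erase Finset.univ _ (Finset.mem_univ j₀), ← mul_assoc]
  refine mul_le_mul ?_ ?_ (by positivity) ?_
  · simpa using hε (σ j₀)
  · refine Finset.prod_le_prod (fun _ _ => abs_nonneg _) fun j hj => ?_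
    rw [Matrix.updateCol_ne (Finset.ne_of_mem_erase hj)]
    exact (abs_coeff_le_polyHeight _ _).trans (hH _)
  · exact (abs_nonneg _).trans (hε _)

/-! ### Families `P, X P, X² P, …` -/

section Families

variable {p q : ℚ[X]} {a b : ℕ}

/-- The family `p, X p, …, X ^ (a - 1) p, q, X q, …, X ^ (b - 1) q`. -/
def shiftFamily {R : Type*} [Semiring R] (a b : ℕ) (p q : R[X]) : Fin a ⊕ Fin b → R[X] :=
  Sum.elim (fun i => X ^ (i : ℕ) * p) fun i => X ^ (i : ℕ) * q

lemma sum_smul_shiftFamily (g : Fin a ⊕ Fin b → ℚ) :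
    ∑ i, g i • shiftFamily a b p q i =
      (∑ i : Fin a, C (g (.inl i)) * X ^ (i : ℕ)) * p +
        (∑ i : Fin b, C (g (.inr i)) * X ^ (i : ℕ)) * q := by
  simp only [Fintype.sum_sum_type, shiftFamily, Sum.elim_inl, Sum.elim_inr, Finset.sum_mul,
    smul_eq_C_mul, mul_assoc]

lemma coeff_sum_fin_C_mul_X_pow (g : Fin a → ℚ) (i : Fin a) :
    (∑ j : Fin a, C (g j) * X ^ (j : ℕ)).coeff i = g i := by
  simp [finsetSum_coeff, coeff_C_mul, coeff_X_pow, Fin.val_inj]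

lemma linearIndependent_shiftFamily
    (h : ∀ A B : ℚ[X], A.degree < a → B.degree < b → A * p + B * q = 0 → A = 0 ∧ B = 0) :
    LinearIndependent ℚ (shiftFamily a b p q) := by
  rw [Fintype.linearIndependent_iff]
  intro g hg
  rw [sum_smul_shiftFamily] at hg
  obtain ⟨hA, hB⟩ := h _ _ (degree_sum_fin_lt _) (degree_sum_fin_lt _) hg
  rintro (i | i)
  · rw [← coeff_sum_fin_C_mul_X_pow (fun i => g (.inl i)) i, hA, coeff_zero]
  · rw [← coeff_sum_fin_C_mul_X_pow (fun i => g (.inr i)) i, hB, coeff_zero]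

lemma exists_of_mem_span_shiftFamily {x : ℚ[X]}
    (hx : x ∈ Submodule.span ℚ (Set.range (shiftFamily a b p q))) :
    ∃ A B : ℚ[X], A.degree < a ∧ B.degree < b ∧ x = A * p + B * q := by
  obtain ⟨g, rfl⟩ := (Submodule.mem_span_range_iff_exists_fun ℚ).mp hx
  exact ⟨_, _, degree_sum_fin_lt _, degree_sum_fin_lt _, sum_smul_shiftFamily g⟩

lemma ratPoly_shiftFamily (P Q : ℤ[X]) (i : Fin a ⊕ Fin b) :
    ratPoly (shiftFamily a b P Q i) = shiftFamily a b (ratPoly P) (ratPoly Q) i := by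
  rcases i with i | i <;> simp [shiftFamily, ratPoly]

/-- A relation `A p + B q = 0` between coprime polynomials with cofactors of degree less than
`deg p` is trivial. -/
lemma eq_zero_of_mul_add_mul_eq_zero (hpq : IsCoprime p q) (hp : p ≠ 0) {A B : ℚ[X]}
    (hB : B.degree < p.degree) (h : A * p + B * q = 0) : A = 0 ∧ B = 0 := by
  have hdvd : p ∣ B := hpq.dvd_of_dvd_mul_right ⟨-A, by linear_combination h⟩
  have hB0 : B = 0 := by
    by_contra hne
    exact (degree_le_of_dvd hdvd hne).not_gt hB
  refine ⟨?_, hB0⟩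
  simpa [hB0, hp] using h

/-- If all of `r, X r, …, X ^ (m - 1) r` lie in the span of `X ^ i p`, `X ^ i q` with `i < m`, for
coprime `p`, `q` with `m < deg p`, then `r` is in the span of `p` and `q`. -/
lemma exists_eq_of_forall_mem_span (hpq : IsCoprime p q) {m : ℕ} (hm : 0 < m)
    (hp : (m : WithBot ℕ) < p.degree) {r : ℚ[X]}
    (hr : ∀ j < m, X ^ j * r ∈ Submodule.span ℚ (Set.range (shiftFamily m m p q))) :
    ∃ a b : ℚ, r = C a * p + C b * q := by
  have hp0 : p ≠ 0 := by rintro rfl; simp at hp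
  obtain ⟨A, B, hA, hB, hAB⟩ := exists_of_mem_span_shiftFamily (hr 0 hm)
  rw [pow_zero, one_mul] at hAB
  have key : ∀ j < m, (X ^ j * A).degree < (m : WithBot ℕ) ∧ (X ^ j * B).degree < (m : WithBot ℕ) := by
    intro j
    induction j with
    | zero => intro _; simpa using ⟨hA, hB⟩
    | succ j ih =>
      intro hj
      obtain ⟨A', B', hA', hB', h'⟩ := exists_of_mem_span_shiftFamily (hr (j + 1) hj)
      obtain ⟨-, ihB⟩ := ih (by omega)
      have hXB : (X ^ (j + 1) * B).degree ≤ (m : WithBot ℕ) := by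
        rw [pow_succ', mul_assoc, degree_mul, degree_X, add_comm]
        by_cases h0 : X ^ j * B = 0
        · simp [h0]
        · rw [degree_eq_natDegree h0] at ihB ⊢
          norm_cast at ihB ⊢
      have hd : (B' - X ^ (j + 1) * B).degree < p.degree :=
        ((degree_sub_le _ _).trans (max_le hB'.le hXB)).trans_lt hp
      obtain ⟨h1, h2⟩ := eq_zero_of_mul_add_mul_eq_zero hpq hp0
        (A := A' - X ^ (j + 1) * A) hd (by
          rw [hAB] at h'; linear_combination -h')
      rw [← sub_eq_zero.mp h1, ← sub_eq_zero.mp h2]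
      exact ⟨hA', hB'⟩
  have hconst : ∀ {D : ℚ[X]}, (X ^ (m - 1) * D).degree < (m : WithBot ℕ) → ∃ d, D = C d := by
    intro D hD
    refine ⟨D.coeff 0, eq_C_of_degree_le_zero ?_⟩
    by_cases hD0 : D = 0
    · simp [hD0]
    rw [degree_mul, degree_X_pow, degree_eq_natDegree hD0] at hD
    rw [degree_eq_natDegree hD0]
    norm_cast at hD ⊢
    omega
  obtain ⟨h1, h2⟩ := key (m - 1) (by omega)
  obtain ⟨a, rfl⟩ := hconst h1
  obtain ⟨b, rfl⟩ := hconst h2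
  exact ⟨a, b, hAB⟩

end Families

lemma abs_aeval_X_pow_mul_le (ξ : ℝ) (Q : ℤ[X]) {i n : ℕ} (hi : i ≤ n) :
    |aeval ξ (X ^ i * Q)| ≤ max 1 |ξ| ^ n * |aeval ξ Q| := by
  rw [map_mul, abs_mul, map_pow, aeval_X, abs_pow]
  gcongr
  exact (pow_le_pow_left₀ (abs_nonneg _) (le_max_right _ _) _).trans
    (pow_le_pow_right₀ (le_max_left _ _) hi)

/-! ### Values of polynomials of degree less than `n` -/

lemma uniformExpSet_mono {n : ℕ} {ξ w v : ℝ} (hw : w ∈ uniformExpSet n ξ) (hv : v ≤ w) :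
    v ∈ uniformExpSet n ξ := by
  filter_upwards [hw, eventually_ge_atTop 1] with X ⟨P, h1, h2, h3, h4⟩ hX
  exact ⟨P, h1, h2, h3, h4.trans_le (Real.rpow_le_rpow_of_exponent_le hX (by linarith))⟩

/-- Irreducible polynomials of degree less than `n` and large height are not too small at `ξ`. -/
lemma exists_forall_irreducible_rpow_le {n : ℕ} (hn : 2 ≤ n) {ξ w : ℝ}
    (hw : w ∈ uniformExpSet n ξ) (hw2 : 2 * (n : ℝ) - 2 < w) :
    ∃ B : ℕ, ∀ Q : ℤ[X], Irreducible Q → Q.natDegree ≠ 0 → Q.natDegree < n →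
      B ≤ polyHeight Q → (polyHeight Q : ℝ) ^ (-w) ≤ |aeval ξ Q| := by
  have hn' : (2 : ℝ) ≤ n := by exact_mod_cast hn
  set a : ℝ := 1 / (2 * ((n + 1) * 2 ^ n)) with ha
  have ha0 : 0 < a := by positivity
  have ha1 : a ≤ 1 := by
    rw [ha, div_le_one (by positivity)]
    have : (1 : ℝ) ≤ 2 ^ n := one_le_pow₀ (by norm_num)
    nlinarith
  have ha2 : ((n : ℝ) + 1) * a < (2 ^ n)⁻¹ := by
    rw [ha, show ((n : ℝ) + 1) * (1 / (2 * ((n + 1) * 2 ^ n))) = (2 ^ n)⁻¹ / 2 by field_simp]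
    have : (0 : ℝ) < (2 ^ n)⁻¹ := by positivity
    linarith
  set K : ℝ := max 1 |ξ| ^ n with hK
  have hK0 : 0 < K := by positivity
  set D : ℝ := (2 * n).factorial * (K * a ^ (-w)) with hD
  have hlim : Tendsto (fun H : ℝ => D * H ^ (-(w - (2 * (n : ℝ) - 2)))) atTop (nhds (D * 0)) :=
    (tendsto_rpow_neg_atTop (by linarith)).const_mul _
  rw [mul_zero] at hlim
  have hev := (tendsto_id.const_mul_atTop ha0).eventually hw
  obtain ⟨B₀, hB₀⟩ := eventually_atTop.mp (hev.and (hlim.eventually_lt_const one_pos))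
  refine ⟨⌈B₀⌉₊, fun Q hQ hd0 hdn hB => ?_⟩
  obtain ⟨⟨P, hPd, hPH, hP0, hPe⟩, hsmall⟩ := hB₀ (polyHeight Q) ((Nat.le_ceil _).trans
    (by exact_mod_cast hB))
  simp only [id] at hPH hPe
  by_contra! hcon
  have hQ0 : Q ≠ 0 := hQ.ne_zero
  have hPne : P ≠ 0 := by rintro rfl; simp at hP0
  have hH1 : (1 : ℝ) ≤ polyHeight Q := by exact_mod_cast one_le_polyHeight hQ0
  set H : ℝ := ((polyHeight Q : ℕ) : ℝ) with hH
  have hH0 : 0 < H := by linarith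
  have hndvd : ¬ Q ∣ P := by
    rintro ⟨R, rfl⟩
    have hR0 : R ≠ 0 := by rintro rfl; simp at hPne
    have h1 := intMahler_le hPd
    have h2 := polyHeight_le_intMahler hdn.le
    rw [intMahler_mul] at h1
    have h3 := one_le_intMahler hR0
    have h4 := one_le_intMahler hQ0
    have h5 : intMahler Q ≤ (n + 1) * (a * H) :=
      (le_mul_of_one_le_right (by linarith) h3).trans (h1.trans (by gcongr))
    have h6 : (n + 1) * (a * H) < (2 ^ n)⁻¹ * H := by
      rw [← mul_assoc]; gcongr
    have h7 : (2 ^ n)⁻¹ * H ≤ intMahler Q := by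
      rw [inv_mul_le_iff₀ (by positivity)]; exact h2
    linarith
  have hprim : Q.IsPrimitive := hQ.isPrimitive hd0
  have hirr : Irreducible (ratPoly Q) :=
    (IsPrimitive.Int.irreducible_iff_irreducible_map_cast hprim).mp hQ
  have hcop : IsCoprime (ratPoly Q) (ratPoly P) := by
    refine (hirr.coprime_iff_not_dvd).mpr fun hdvd => hndvd ?_
    exact (IsPrimitive.Int.dvd_iff_map_cast_dvd_map_cast _ _ hprim).mpr hdvd
  set m := Q.natDegree with hm
  have hdegQ : (ratPoly Q).degree = m := by
    rw [ratPoly, degree_map_eq_of_injective Int.cast_injective, degree_eq_natDegree hQ0]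
  have hli : LinearIndependent ℚ fun i => ratPoly (shiftFamily n m Q P i) := by
    simp only [ratPoly_shiftFamily]
    refine linearIndependent_shiftFamily fun A B _ hB h => ?_
    exact eq_zero_of_mul_add_mul_eq_zero hcop hirr.ne_zero (hB.trans_eq hdegQ.symm) h
  have hcard : Fintype.card (Fin n ⊕ Fin m) = n + m := by simp
  have : Nonempty (Fin n ⊕ Fin m) := ⟨.inl ⟨0, by omega⟩⟩
  have haw : 1 ≤ a ^ (-w) := Real.one_le_rpow_of_pos_of_le_one_of_nonpos ha0 ha1 (by linarith)
  have hPe' : |aeval ξ P| ≤ a ^ (-w) * H ^ (-w) := by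
    rw [← Real.mul_rpow ha0.le hH0.le]; exact hPe.le
  have hQe' : |aeval ξ Q| ≤ a ^ (-w) * H ^ (-w) :=
    hcon.le.trans (le_mul_of_one_le_left (by positivity) haw)
  have hbd := one_le_of_linearIndependent ξ (shiftFamily n m Q P) (by
      rw [hcard]
      rintro (i | i)
      · refine (natDegree_mul_le).trans_lt ?_
        rw [natDegree_X_pow]
        have := i.2
        omega
      · refine (natDegree_mul_le).trans_lt ?_
        rw [natDegree_X_pow]
        have := i.2
        omega) hli (fun _ => H) (K * (a ^ (-w) * H ^ (-w)) / H) (by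
      rintro (i | i)
      · exact Nat.cast_le.mpr (polyHeight_X_pow_mul_le Q i)
      · refine le_trans (Nat.cast_le.mpr (polyHeight_X_pow_mul_le P i)) (hPH.trans ?_)
        exact mul_le_of_le_one_left hH0.le ha1) (by
      intro i
      rw [div_mul_cancel₀ _ hH0.ne']
      rcases i with i | i
      · exact (abs_aeval_X_pow_mul_le ξ Q i.2.le).trans (by gcongr)
      · exact (abs_aeval_X_pow_mul_le ξ P (i.2.le.trans hdn.le)).trans (by gcongr))
  rw [hcard, Finset.prod_const, Finset.card_univ, hcard] at hbd
  refine absurd hbd (not_le.mpr (lt_of_le_of_lt ?_ hsmall))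
  have hpow : H ^ (n + m) ≤ H ^ (2 * n - 1) := pow_le_pow_right₀ hH1 (by omega)
  have hfac : ((n + m).factorial : ℝ) ≤ (2 * n).factorial := by
    exact_mod_cast Nat.factorial_le (by omega)
  calc ((n + m).factorial : ℝ) * (K * (a ^ (-w) * H ^ (-w)) / H * H ^ (n + m))
      ≤ (2 * n).factorial * (K * (a ^ (-w) * H ^ (-w)) / H * H ^ (2 * n - 1)) := by gcongr
    _ = D * (H ^ (-w) * H ^ (2 * n - 1) / H) := by rw [hD]; ring
    _ = D * H ^ (-(w - (2 * (n : ℝ) - 2))) := by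
      congr 1
      rw [show -(w - (2 * (n : ℝ) - 2)) = -w + ((2 * n - 2 : ℕ) : ℝ) by
        rw [Nat.cast_sub (by omega)]; push_cast; ring, Real.rpow_add hH0, Real.rpow_natCast,
        show 2 * n - 1 = (2 * n - 2) + 1 by omega, pow_succ]
      field_simp

/-- A lower bound for the values at `ξ` of polynomials of degree less than `n`, in a form that is
multiplicative. -/
lemma exists_pow_natDegree_le {n : ℕ} (hn : 2 ≤ n) {ξ w : ℝ}
    (hw : w ∈ uniformExpSet n ξ) (hw2 : 2 * (n : ℝ) - 2 < w)
    (hpos : ∀ B : ℕ, ∃ δ > 0, ∀ Q : ℤ[X], Q ≠ 0 → Q.natDegree ≤ n → polyHeight Q ≤ B →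
      δ ≤ |aeval ξ Q|) :
    ∃ c : ℝ, 0 < c ∧ c ≤ 1 ∧ ∀ Q : ℤ[X], Q ≠ 0 → Q.natDegree < n →
      c ^ Q.natDegree ≤ |aeval ξ Q| * intMahler Q ^ w := by
  have hn' : (2 : ℝ) ≤ n := by exact_mod_cast hn
  have hw0 : 0 < w := by linarith
  obtain ⟨B, hB⟩ := exists_forall_irreducible_rpow_le hn hw hw2
  obtain ⟨δ, hδ, hδB⟩ := hpos B
  set c : ℝ := min 1 (min δ (((2 : ℝ) ^ n) ^ (-w))) with hc
  have hc0 : 0 < c := lt_min one_pos (lt_min hδ (by positivity))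
  have hc1 : c ≤ 1 := min_le_left _ _
  refine ⟨c, hc0, hc1, ?_⟩
  have hzero : ∀ Q : ℤ[X], Q ≠ 0 → Q.natDegree = 0 →
      c ^ Q.natDegree ≤ |aeval ξ Q| * intMahler Q ^ w := by
    intro Q hQ0 hQ
    rw [hQ, pow_zero]
    refine one_le_mul_of_one_le_of_one_le ?_ (Real.one_le_rpow (one_le_intMahler hQ0) hw0.le)
    rw [eq_C_of_natDegree_eq_zero hQ] at hQ0 ⊢
    rw [aeval_C, algebraMap_int_eq, eq_intCast]
    exact_mod_cast Int.one_le_abs (by simpa using hQ0)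
  intro Q
  induction Q using WfDvdMonoid.induction_on_irreducible with
  | zero => intro h; exact absurd rfl h
  | unit u hu => intro h0 _; exact hzero u h0 (natDegree_eq_zero_of_isUnit hu)
  | mul R Q hR hQ ih =>
    intro _ hdeg
    have hQ0 := hQ.ne_zero
    rw [natDegree_mul hQ0 hR] at hdeg ⊢
    have hM := one_le_intMahler hQ0
    have hMR := one_le_intMahler hR
    have hQb : c ^ Q.natDegree ≤ |aeval ξ Q| * intMahler Q ^ w := by
      by_cases hd : Q.natDegree = 0
      · exact hzero Q hQ0 hd
      refine (pow_le_of_le_one hc0.le hc1 hd).trans ?_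
      rcases lt_or_ge (polyHeight Q) B with hlt | hge
      · calc c ≤ δ * 1 := by rw [mul_one]; exact (min_le_right _ _).trans (min_le_left _ _)
          _ ≤ _ := mul_le_mul (hδB Q hQ0 (by omega) hlt.le) (Real.one_le_rpow hM hw0.le)
            zero_le_one (abs_nonneg _)
      · have hH : (0 : ℝ) < polyHeight Q := by exact_mod_cast one_le_polyHeight hQ0
        calc c ≤ ((2 : ℝ) ^ n) ^ (-w) := (min_le_right _ _).trans (min_le_right _ _)
          _ = ((2 : ℝ) ^ n * intMahler Q) ^ (-w) * intMahler Q ^ w := by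
            rw [Real.mul_rpow (by positivity) (by linarith), mul_assoc,
              ← Real.rpow_add (by linarith)]
            simp
          _ ≤ (polyHeight Q : ℝ) ^ (-w) * intMahler Q ^ w := by
            refine mul_le_mul_of_nonneg_right ?_ (by positivity)
            exact Real.rpow_le_rpow_of_nonpos hH (polyHeight_le_intMahler (by omega)) (by linarith)
          _ ≤ _ := by
            refine mul_le_mul_of_nonneg_right (hB Q hQ hd (by omega) hge) (by positivity)
    have hRb := ih hR (by omega)
    calc c ^ (Q.natDegree + R.natDegree) = c ^ Q.natDegree * c ^ R.natDegree := pow_add _ _ _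
      _ ≤ (|aeval ξ Q| * intMahler Q ^ w) * (|aeval ξ R| * intMahler R ^ w) := by gcongr
      _ = _ := by
        rw [map_mul, abs_mul, intMahler_mul, Real.mul_rpow (by linarith) (by linarith)]; ring

/-! ### Two-dimensional spaces of polynomials -/

lemma aeval_ratPoly (ξ : ℝ) (Q : ℤ[X]) : aeval ξ (ratPoly Q) = aeval ξ Q := by
  rw [ratPoly, ← algebraMap_int_eq, aeval_map_algebraMap]

lemma coeff_ratPoly (Q : ℤ[X]) (i : ℕ) : (ratPoly Q).coeff i = (Q.coeff i : ℚ) := by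
  simp [ratPoly]

lemma natDegree_ratPoly (Q : ℤ[X]) : (ratPoly Q).natDegree = Q.natDegree :=
  natDegree_map_eq_of_injective Int.cast_injective Q

lemma exists_minor_ne_zero {P Q : ℤ[X]} (h : IsCoprime (ratPoly P) (ratPoly Q))
    (hP : P.natDegree ≠ 0) : ∃ i j, P.coeff i * Q.coeff j - P.coeff j * Q.coeff i ≠ 0 := by
  by_contra! hcon
  have hlead : (P.coeff P.natDegree : ℚ) ≠ 0 := by
    have : P ≠ 0 := by rintro rfl; simp at hP
    simpa using this
  have heq : C (P.coeff P.natDegree : ℚ) * ratPoly Q = ratPoly P * C (Q.coeff P.natDegree : ℚ) := by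
    ext i
    have := hcon i P.natDegree
    simp only [coeff_C_mul, coeff_mul_C, coeff_ratPoly]
    have h2 : (P.coeff i : ℚ) * Q.coeff P.natDegree - P.coeff P.natDegree * Q.coeff i = 0 := by
      exact_mod_cast this
    linarith
  have hdvd : ratPoly P ∣ ratPoly Q :=
    ((isUnit_C.mpr hlead.isUnit).dvd_mul_left).mp ⟨_, heq⟩
  have hunit : IsUnit (ratPoly P) := h.isUnit_of_dvd' dvd_rfl hdvd
  exact hP (by rw [← natDegree_ratPoly, natDegree_eq_zero_of_isUnit hunit])

/-- Two independent integer polynomials from a fixed plane cannot both be small at `ξ`. -/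
lemma exists_pos_le_of_mem_plane {ξ : ℝ} {P Q : ℤ[X]} (h : IsCoprime (ratPoly P) (ratPoly Q))
    (hP : P.natDegree ≠ 0) (hPξ : aeval ξ P ≠ 0) :
    ∃ β > 0, ∀ R S : ℤ[X], IsCoprime (ratPoly R) (ratPoly S) → R.natDegree ≠ 0 →
      (∃ a b : ℚ, ratPoly R = C a * ratPoly P + C b * ratPoly Q) →
      (∃ a b : ℚ, ratPoly S = C a * ratPoly P + C b * ratPoly Q) →
      β ≤ polyHeight R * |aeval ξ S| + polyHeight S * |aeval ξ R| := by
  obtain ⟨i, j, hij⟩ := exists_minor_ne_zero h hP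
  set Δ : ℝ := P.coeff i * Q.coeff j - P.coeff j * Q.coeff i with hΔ
  have hΔ0 : Δ ≠ 0 := by rw [hΔ]; exact_mod_cast hij
  obtain ⟨l, hl⟩ : ∃ l, (P.coeff l : ℝ) * aeval ξ Q - Q.coeff l * aeval ξ P ≠ 0 := by
    by_contra! hcon
    have h1 := hcon i
    have h2 := hcon j
    have : aeval ξ P * Δ = 0 := by
      rw [hΔ]; linear_combination (P.coeff j : ℝ) * h1 - (P.coeff i : ℝ) * h2
    exact (mul_ne_zero hPξ hΔ0) this
  set θ : ℝ := P.coeff l * aeval ξ Q - Q.coeff l * aeval ξ P with hθ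
  refine ⟨|θ| / |Δ|, by positivity, ?_⟩
  rintro R S hRS hR ⟨a, b, hab⟩ ⟨c, d, hcd⟩
  have hRc : ∀ m, (R.coeff m : ℝ) = a * P.coeff m + b * Q.coeff m := fun m => by
    have := congrArg (fun p => (coeff p m : ℚ)) hab
    simp only [coeff_add, coeff_C_mul, coeff_ratPoly] at this
    exact_mod_cast this
  have hSc : ∀ m, (S.coeff m : ℝ) = c * P.coeff m + d * Q.coeff m := fun m => by
    have := congrArg (fun p => (coeff p m : ℚ)) hcd
    simp only [coeff_add, coeff_C_mul, coeff_ratPoly] at this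
    exact_mod_cast this
  have hRe : aeval ξ R = a * aeval ξ P + b * aeval ξ Q := by
    simpa [aeval_ratPoly] using congrArg (aeval ξ) hab
  have hSe : aeval ξ S = c * aeval ξ P + d * aeval ξ Q := by
    simpa [aeval_ratPoly] using congrArg (aeval ξ) hcd
  set e : ℝ := a * d - b * c with he
  have hminor : ∀ s t, (R.coeff s : ℝ) * S.coeff t - R.coeff t * S.coeff s =
      e * (P.coeff s * Q.coeff t - P.coeff t * Q.coeff s) := fun s t => by
    rw [hRc, hRc, hSc, hSc, he]; ring
  have he0 : e ≠ 0 := by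
    obtain ⟨s, t, hst⟩ := exists_minor_ne_zero hRS hR
    intro he0
    have := hminor s t
    rw [he0, zero_mul] at this
    exact hst (by exact_mod_cast this)
  have hone : 1 ≤ |e| * |Δ| := by
    have h1 := hminor i j
    rw [← hΔ] at h1
    have h2 : R.coeff i * S.coeff j - R.coeff j * S.coeff i ≠ 0 := by
      intro h0
      have h3 : (R.coeff i : ℝ) * S.coeff j - R.coeff j * S.coeff i = 0 := by exact_mod_cast h0
      rw [h3] at h1
      exact mul_ne_zero he0 hΔ0 h1.symm
    rw [← abs_mul, ← h1]
    exact_mod_cast Int.one_le_abs h2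
  have hval : (R.coeff l : ℝ) * aeval ξ S - S.coeff l * aeval ξ R = e * θ := by
    rw [hRc, hSc, hRe, hSe, he, hθ]; ring
  calc |θ| / |Δ| ≤ |e| * |θ| := by
        rw [div_le_iff₀ (by positivity)]
        nlinarith [abs_nonneg θ]
    _ = |(R.coeff l : ℝ) * aeval ξ S - S.coeff l * aeval ξ R| := by rw [hval, abs_mul]
    _ ≤ |(R.coeff l : ℝ)| * |aeval ξ S| + |(S.coeff l : ℝ)| * |aeval ξ R| := by
        rw [← abs_mul, ← abs_mul]; exact abs_sub _ _
    _ ≤ _ := by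
        gcongr <;> exact abs_coeff_le_polyHeight _ _

/-! ### Best approximation polynomials -/

namespace IsBestApproxSeq

variable {n : ℕ} {ξ : ℝ} {P : ℕ → ℤ[X]}

lemma aeval_ne_zero (hP : IsBestApproxSeq n ξ P) {k : ℕ} (hk : 1 ≤ k) : aeval ξ (P k) ≠ 0 :=
  abs_pos.mp ((abs_nonneg _).trans_lt (hP.eval_lt k hk))

lemma height_le (hP : IsBestApproxSeq n ξ P)
    {i j : ℕ} (hi : 1 ≤ i) (hij : i ≤ j) : polyHeight (P i) ≤ polyHeight (P j) := by
  induction j, hij using Nat.le_induction with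
  | base => exact le_rfl
  | succ j hj ih => exact ih.trans (hP.height_lt j (hi.trans hj)).le

lemma abs_aeval_le (hP : IsBestApproxSeq n ξ P)
    {i j : ℕ} (hi : 1 ≤ i) (hij : i ≤ j) : |aeval ξ (P j)| ≤ |aeval ξ (P i)| :=
  hP.isMin j (hi.trans hij) _ (hP.ne_zero i hi) (hP.deg_le i hi) (hP.height_le hi hij)

lemma le_height (hP : IsBestApproxSeq n ξ P) {k : ℕ} (hk : 1 ≤ k) : k ≤ polyHeight (P k) := by
  induction k, hk using Nat.le_induction with
  | base => exact one_le_polyHeight (hP.ne_zero 1 le_rfl)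
  | succ j hj ih => exact ih.trans_lt (hP.height_lt j hj)

lemma tendsto_height (hP : IsBestApproxSeq n ξ P) :
    Tendsto (fun k => (polyHeight (P k) : ℝ)) atTop atTop := by
  refine tendsto_natCast_atTop_atTop.comp (tendsto_atTop_mono' _ ?_ tendsto_id)
  filter_upwards [eventually_ge_atTop 1] with k hk using hP.le_height hk

/-- `P_k` is minimal at `ξ` among all polynomials of height less than `H_{k+1}`. -/
lemma abs_aeval_le_of_height_lt (hP : IsBestApproxSeq n ξ P)
    {k : ℕ} (hk : 1 ≤ k) {Q : ℤ[X]} (hQ : Q ≠ 0)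
    (hd : Q.natDegree ≤ n) (hH : polyHeight Q < polyHeight (P (k + 1))) :
    |aeval ξ (P k)| ≤ |aeval ξ Q| := by
  have hfin : {R : ℤ[X] | R ≠ 0 ∧ R.natDegree ≤ n ∧ polyHeight R ≤ polyHeight Q}.Finite :=
    (finite_polyHeight_le n (polyHeight Q)).subset fun R hR => hR.2
  obtain ⟨R, ⟨hR0, hRd, hRH⟩, hmin⟩ :=
    Set.exists_min_image _ (fun R => |aeval ξ R|) hfin ⟨Q, hQ, hd, le_rfl⟩
  refine le_trans ?_ (hmin Q ⟨hQ, hd, le_rfl⟩)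
  obtain ⟨l, hl, hRl⟩ := hP.complete R hR0 hRd fun S hS0 hSd hSH =>
    hmin S ⟨hS0, hSd, hSH.trans hRH⟩
  have hheq : polyHeight R = polyHeight (P l) := by
    rcases hRl with rfl | rfl
    · rfl
    · simp [polyHeight]
  have hveq : |aeval ξ R| = |aeval ξ (P l)| := by
    rcases hRl with rfl | rfl <;> simp
  have hlk : l ≤ k := by
    by_contra! hlt
    have := hP.height_le (i := k + 1) (j := l) (by omega) hlt
    omega
  rw [hveq]
  exact hP.abs_aeval_le hl hlk

lemma eventually_abs_aeval_le (hP : IsBestApproxSeq n ξ P)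
    {w v : ℝ} (hw : w ∈ uniformExpSet n ξ) (hvw : v < w) :
    ∀ᶠ k in atTop, |aeval ξ (P k)| ≤ (polyHeight (P (k + 1)) : ℝ) ^ (-v) := by
  have h1 : ∀ᶠ X : ℝ in atTop, (X / 2) ^ (-w) ≤ X ^ (-v) := by
    have := (tendsto_rpow_neg_atTop (sub_pos.mpr hvw)).eventually_le_const
      (show (0 : ℝ) < (2⁻¹ : ℝ) ^ w by positivity)
    filter_upwards [this, eventually_gt_atTop 0] with X hX hX0
    rw [div_eq_mul_inv, Real.mul_rpow hX0.le (by norm_num),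
      show -w = -(w - v) + -v by ring, Real.rpow_add hX0, mul_right_comm]
    refine mul_le_of_le_one_left (by positivity) ?_
    calc X ^ (-(w - v)) * (2⁻¹ : ℝ) ^ (-(w - v) + -v)
        ≤ (2⁻¹ : ℝ) ^ w * (2⁻¹ : ℝ) ^ (-(w - v) + -v) := by gcongr
      _ = 1 := by rw [← Real.rpow_add (by norm_num)]; ring_nf; simp
  have h2 := (tendsto_id.atTop_div_const (two_pos : (0 : ℝ) < 2)).eventually hw
  have h3 := (hP.tendsto_height.comp (tendsto_add_atTop_nat 1)).eventually (h1.and h2)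
  filter_upwards [h3, eventually_ge_atTop 1] with k ⟨hk1, Q, hQd, hQH, hQ0, hQe⟩ hk
  simp only [Function.comp, id] at hk1 hQH hQe
  refine le_trans ?_ (hQe.le.trans hk1)
  refine hP.abs_aeval_le_of_height_lt hk (by rintro rfl; simp at hQ0) hQd ?_
  have h0 : (0 : ℝ) < polyHeight (P (k + 1)) := by
    exact_mod_cast one_le_polyHeight (hP.ne_zero (k + 1) (by omega))
  have : (polyHeight Q : ℝ) < polyHeight (P (k + 1)) := by linarith
  exact_mod_cast this

lemma exists_pos_le (hP : IsBestApproxSeq n ξ P)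
    (B : ℕ) : ∃ δ > 0, ∀ Q : ℤ[X], Q ≠ 0 → Q.natDegree ≤ n → polyHeight Q ≤ B →
    δ ≤ |aeval ξ Q| :=
  ⟨|aeval ξ (P (B + 1))|, abs_pos.mpr (hP.aeval_ne_zero (by omega)), fun Q hQ hd hH =>
    hP.isMin (B + 1) (by omega) Q hQ hd
      (hH.trans ((Nat.le_succ B).trans (hP.le_height (by omega))))⟩

lemma isUnit_C_of_mul_eq (hP : IsBestApproxSeq n ξ P)
    {k : ℕ} (hk : 1 ≤ k) {Q : ℤ[X]} {z : ℤ} (h : P k = Q * C z) :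
    IsUnit (C z) := by
  have hz : z ≠ 0 := by
    rintro rfl
    exact hP.ne_zero k hk (by simpa using h)
  have hQ0 : Q ≠ 0 := by
    rintro rfl
    exact hP.ne_zero k hk (by simpa using h)
  have hQd : Q.natDegree ≤ n := by
    have := hP.deg_le k hk
    rwa [h, natDegree_mul_C hz] at this
  have hQH : polyHeight Q ≤ polyHeight (P k) := polyHeight_le fun i => by
    refine le_trans ?_ (natAbs_coeff_le_polyHeight (P k) i)
    rw [h, coeff_mul_C, Int.natAbs_mul]
    exact Nat.le_mul_of_pos_right _ (Int.natAbs_pos.mpr hz)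
  have hmin := hP.isMin k hk Q hQ0 hQd hQH
  have hne := abs_pos.mpr (hP.aeval_ne_zero hk)
  rw [h, map_mul, aeval_C, abs_mul, algebraMap_int_eq, eq_intCast] at hmin hne
  have hpos : 0 < |aeval ξ Q| := pos_of_mul_pos_left hne (abs_nonneg _)
  have hz1 : |(z : ℝ)| ≤ 1 := by
    by_contra! hlt
    nlinarith
  have hz2 : |z| ≤ 1 := by exact_mod_cast hz1
  exact isUnit_C.mpr (Int.isUnit_iff_abs_eq.mpr (le_antisymm hz2 (Int.one_le_abs hz)))

lemma eventually_irreducible (hP : IsBestApproxSeq n ξ P)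
    (hn : 2 ≤ n) {w : ℝ} (hw : w ∈ uniformExpSet n ξ)
    (hw2 : 2 * (n : ℝ) - 2 < w) :
    ∀ᶠ k in atTop, Irreducible (P k) ∧ (P k).natDegree = n := by
  have hn' : (2 : ℝ) ≤ n := by exact_mod_cast hn
  obtain ⟨u, hu1, hu2⟩ := exists_between hw2
  obtain ⟨v, hv1, hv2⟩ := exists_between hu1
  obtain ⟨c, hc0, hc1, hc⟩ := exists_pow_natDegree_le hn
    (uniformExpSet_mono hw (hv2.trans hu2).le) hv1 hP.exists_pos_le
  have hlim : Tendsto (fun H : ℝ => ((n : ℝ) + 1) ^ v * H ^ (-(u - v))) atTop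
      (nhds (((n : ℝ) + 1) ^ v * 0)) := (tendsto_rpow_neg_atTop (by linarith)).const_mul _
  rw [mul_zero] at hlim
  have hsmall := hP.tendsto_height.eventually
    (hlim.eventually_lt_const (show 0 < c ^ n by positivity))
  filter_upwards [hsmall, hP.eventually_abs_aeval_le hw hu2, eventually_ge_atTop 1]
    with k hk1 hk2 hk
  have hk0 := hP.ne_zero k hk
  have hkd := hP.deg_le k hk
  have hH : (0 : ℝ) < polyHeight (P k) := by exact_mod_cast one_le_polyHeight hk0
  have hf : |aeval ξ (P k)| * intMahler (P k) ^ v < c ^ n := by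
    refine lt_of_le_of_lt ?_ hk1
    have h1 : |aeval ξ (P k)| ≤ (polyHeight (P k) : ℝ) ^ (-u) := by
      refine hk2.trans (Real.rpow_le_rpow_of_nonpos hH ?_ (by linarith))
      exact_mod_cast (hP.height_lt k hk).le
    have h2 : intMahler (P k) ^ v ≤ ((n + 1) * polyHeight (P k)) ^ v :=
      Real.rpow_le_rpow (by linarith [one_le_intMahler hk0]) (intMahler_le hkd) (by linarith)
    calc |aeval ξ (P k)| * intMahler (P k) ^ v
        ≤ (polyHeight (P k) : ℝ) ^ (-u) * ((n + 1) * polyHeight (P k)) ^ v :=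
          mul_le_mul h1 h2 (Real.rpow_nonneg (by linarith [one_le_intMahler hk0]) _)
            (by positivity)
      _ = _ := by
        rw [Real.mul_rpow (by positivity) hH.le, show -(u - v) = -u + v by ring,
          Real.rpow_add hH]
        ring
  have hdeg : (P k).natDegree = n := by
    by_contra hne
    have := hc (P k) hk0 (lt_of_le_of_ne hkd hne)
    have h2 : c ^ n ≤ c ^ (P k).natDegree := pow_le_pow_of_le_one hc0.le hc1 hkd
    linarith
  refine ⟨⟨fun hu => ?_, fun A B hAB => ?_⟩, hdeg⟩
  · rw [natDegree_eq_zero_of_isUnit hu] at hdeg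
    omega
  have hA0 : A ≠ 0 := by rintro rfl; simp [hAB] at hk0
  have hB0 : B ≠ 0 := by rintro rfl; simp [hAB] at hk0
  have hsum : A.natDegree + B.natDegree = n := by rw [← natDegree_mul hA0 hB0, ← hAB, hdeg]
  rcases Nat.eq_zero_or_pos A.natDegree with hA | hA
  · left
    rw [eq_C_of_natDegree_eq_zero hA] at hAB ⊢
    exact hP.isUnit_C_of_mul_eq hk (by rw [hAB, mul_comm])
  rcases Nat.eq_zero_or_pos B.natDegree with hB | hB
  · right
    rw [eq_C_of_natDegree_eq_zero hB] at hAB ⊢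
    exact hP.isUnit_C_of_mul_eq hk hAB
  exfalso
  have h1 := hc A hA0 (by omega)
  have h2 := hc B hB0 (by omega)
  have hMA := one_le_intMahler hA0
  have hMB := one_le_intMahler hB0
  refine absurd hf (not_lt.mpr ?_)
  calc c ^ n = c ^ A.natDegree * c ^ B.natDegree := by rw [← pow_add, hsum]
    _ ≤ (|aeval ξ A| * intMahler A ^ v) * (|aeval ξ B| * intMahler B ^ v) := by gcongr
    _ = _ := by
      rw [hAB, map_mul, abs_mul, intMahler_mul, Real.mul_rpow (by linarith) (by linarith)]; ring

lemma isCoprime_of_irreducible (hP : IsBestApproxSeq n ξ P)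
    {k : ℕ} (hk : 1 ≤ k) (hn : n ≠ 0) (hirr : Irreducible (P k))
    (hd : (P k).natDegree = n) : IsCoprime (ratPoly (P k)) (ratPoly (P (k + 1))) := by
  have hprim : (P k).IsPrimitive := hirr.isPrimitive (hd.trans_ne hn)
  have hirr' : Irreducible (ratPoly (P k)) :=
    (IsPrimitive.Int.irreducible_iff_irreducible_map_cast hprim).mp hirr
  refine (hirr'.coprime_iff_not_dvd).mpr fun hdvd => ?_
  obtain ⟨R, hR⟩ := (IsPrimitive.Int.dvd_iff_map_cast_dvd_map_cast _ _ hprim).mpr hdvd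
  have hk1 := hP.ne_zero (k + 1) (by omega)
  have hR0 : R ≠ 0 := by rintro rfl; simp [hR] at hk1
  have hdeg := hP.deg_le (k + 1) (by omega)
  rw [hR, natDegree_mul hirr.ne_zero hR0, hd] at hdeg
  have hRC := eq_C_of_natDegree_eq_zero (show R.natDegree = 0 by omega)
  have hz : R.coeff 0 ≠ 0 := by
    intro h0
    rw [h0, C_0] at hRC
    exact hR0 hRC
  have hlt := hP.eval_lt k hk
  rw [hR, hRC, map_mul, aeval_C, abs_mul, algebraMap_int_eq, eq_intCast] at hlt
  have h1 : (1 : ℝ) ≤ |(R.coeff 0 : ℝ)| := by exact_mod_cast Int.one_le_abs hz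
  nlinarith [abs_nonneg (aeval ξ (P k))]

/-- Infinitely often, `P_{k+2}` is not in the span of `P_k` and `P_{k+1}`. -/
lemma frequently_not_mem_plane (hP : IsBestApproxSeq n ξ P)
    (hn : 2 ≤ n) {w : ℝ} (hw : w ∈ uniformExpSet n ξ)
    (hw2 : 2 * (n : ℝ) - 2 < w) :
    ∃ᶠ k in atTop, ¬ ∃ a b : ℚ,
      ratPoly (P (k + 2)) = C a * ratPoly (P k) + C b * ratPoly (P (k + 1)) := by
  have hn' : (2 : ℝ) ≤ n := by exact_mod_cast hn
  intro hev
  simp only [not_not] at hev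
  obtain ⟨v, hv1, hv2⟩ := exists_between hw2
  obtain ⟨K, hK⟩ := eventually_atTop.mp ((hev.and (hP.eventually_irreducible hn hw hw2)).and
    (eventually_ge_atTop 1))
  have hcop : ∀ k ≥ K, IsCoprime (ratPoly (P k)) (ratPoly (P (k + 1))) := fun k hk =>
    hP.isCoprime_of_irreducible (hK k hk).2 (by omega) (hK k hk).1.2.1 (hK k hk).1.2.2
  have hdeg : ∀ k ≥ K, (P k).natDegree ≠ 0 := fun k hk => by
    rw [(hK k hk).1.2.2]; omega
  obtain ⟨β, hβ, hmain⟩ := exists_pos_le_of_mem_plane (hcop K le_rfl) (hdeg K le_rfl)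
    (hP.aeval_ne_zero (hK K le_rfl).2)
  have hplane : ∀ k ≥ K,
      (∃ a b : ℚ, ratPoly (P k) = C a * ratPoly (P K) + C b * ratPoly (P (K + 1))) ∧
      ∃ a b : ℚ, ratPoly (P (k + 1)) = C a * ratPoly (P K) + C b * ratPoly (P (K + 1)) := by
    intro k hk
    induction k, hk using Nat.le_induction with
    | base => exact ⟨⟨1, 0, by simp⟩, ⟨0, 1, by simp⟩⟩
    | succ k hk ih =>
      refine ⟨ih.2, ?_⟩
      obtain ⟨⟨a, b, hab⟩, c, d, hcd⟩ := ih
      obtain ⟨s, t, hst⟩ := (hK k hk).1.1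
      refine ⟨s * a + t * c, s * b + t * d, ?_⟩
      rw [show k + 1 + 1 = k + 2 from rfl, hst, hab, hcd]
      simp only [C_add, C_mul]
      ring
  have hlim := hP.tendsto_height.comp (tendsto_add_atTop_nat 1)
  have hsmall := hlim.eventually
    ((tendsto_rpow_neg_atTop (show 0 < v - 1 by linarith)).eventually_lt_const (half_pos hβ))
  obtain ⟨k, ⟨hk1, hk2⟩, hk⟩ := ((hsmall.and (hP.eventually_abs_aeval_le hw hv2)).and
    (eventually_ge_atTop K)).exists
  have hk' := (hK k hk).2
  have h1 := hmain _ _ (hcop k hk) (hdeg k hk) (hplane k hk).1 (hplane k hk).2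
  simp only [Function.comp] at hk1
  have hH : (0 : ℝ) < polyHeight (P (k + 1)) := by
    exact_mod_cast one_le_polyHeight (hP.ne_zero (k + 1) (by omega))
  have hHle : (polyHeight (P k) : ℝ) ≤ polyHeight (P (k + 1)) := by
    exact_mod_cast (hP.height_lt k hk').le
  have hpow : polyHeight (P (k + 1)) * (polyHeight (P (k + 1)) : ℝ) ^ (-v) =
      (polyHeight (P (k + 1)) : ℝ) ^ (-(v - 1)) := by
    rw [show -(v - 1) = 1 + -v by ring, Real.rpow_add hH, Real.rpow_one]
  have h2 : polyHeight (P k) * |aeval ξ (P (k + 1))| ≤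
      polyHeight (P (k + 1)) * (polyHeight (P (k + 1)) : ℝ) ^ (-v) :=
    mul_le_mul hHle ((hP.eval_lt k hk').le.trans hk2) (abs_nonneg _) hH.le
  have h3 : polyHeight (P (k + 1)) * |aeval ξ (P k)| ≤
      polyHeight (P (k + 1)) * (polyHeight (P (k + 1)) : ℝ) ^ (-v) :=
    mul_le_mul_of_nonneg_left hk2 hH.le
  linarith

/-- If `P_k`, `P_{k+1}` are coprime of degree `n` and `P_{k+2}` is not in their span, then `P_k`
cannot be too small at `ξ`. -/
lemma one_le_mul_of_not_mem_plane (hP : IsBestApproxSeq n ξ P) (hn : 2 ≤ n) {k : ℕ} (hk : 1 ≤ k)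
    (hcop : IsCoprime (ratPoly (P k)) (ratPoly (P (k + 1)))) (hd : (P k).natDegree = n)
    (hnot : ¬ ∃ a b : ℚ,
      ratPoly (P (k + 2)) = C a * ratPoly (P k) + C b * ratPoly (P (k + 1))) :
    1 ≤ ((2 * n - 1).factorial * max 1 |ξ| ^ n : ℝ) *
      (|aeval ξ (P k)| * polyHeight (P (k + 1)) ^ (2 * n - 3) * polyHeight (P (k + 2))) := by
  have hk0 := hP.ne_zero k hk
  have hdegP : (ratPoly (P k)).degree = n := by
    rw [ratPoly, degree_map_eq_of_injective Int.cast_injective, degree_eq_natDegree hk0, hd]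
  have hlt : ((n - 1 : ℕ) : WithBot ℕ) < (ratPoly (P k)).degree := by
    rw [hdegP]; exact_mod_cast (by omega : n - 1 < n)
  obtain ⟨j, hj, hjmem⟩ : ∃ j < n - 1, X ^ j * ratPoly (P (k + 2)) ∉ Submodule.span ℚ
      (Set.range (shiftFamily (n - 1) (n - 1) (ratPoly (P k)) (ratPoly (P (k + 1))))) := by
    by_contra! hcon
    exact hnot (exists_eq_of_forall_mem_span hcop (by omega) hlt hcon)
  let F : Option (Fin (n - 1) ⊕ Fin (n - 1)) → ℤ[X] := fun o =>
    o.elim (X ^ j * P (k + 2)) (shiftFamily (n - 1) (n - 1) (P k) (P (k + 1)))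
  have hli : LinearIndependent ℚ fun i => ratPoly (F i) := by
    rw [linearIndependent_option]
    have hcomp : ((fun i => ratPoly (F i)) ∘ (↑) : Fin (n - 1) ⊕ Fin (n - 1) → ℚ[X]) =
        shiftFamily (n - 1) (n - 1) (ratPoly (P k)) (ratPoly (P (k + 1))) :=
      funext fun i => ratPoly_shiftFamily _ _ i
    rw [hcomp]
    refine ⟨linearIndependent_shiftFamily fun A B _ hB h => ?_, ?_⟩
    · exact eq_zero_of_mul_add_mul_eq_zero hcop (by rintro h0; simp [h0] at hdegP)
        (hB.trans hlt) h
    · simpa [F, ratPoly] using hjmem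
  have hcard : Fintype.card (Option (Fin (n - 1) ⊕ Fin (n - 1))) = 2 * n - 1 := by
    simp only [Fintype.card_option, Fintype.card_sum, Fintype.card_fin]; omega
  have hH : (0 : ℝ) < polyHeight (P k) := by exact_mod_cast one_le_polyHeight hk0
  have hH01 : (polyHeight (P k) : ℝ) ≤ polyHeight (P (k + 1)) := by
    exact_mod_cast (hP.height_lt k hk).le
  let h : Option (Fin (n - 1) ⊕ Fin (n - 1)) → ℝ := fun o =>
    o.elim (polyHeight (P (k + 2)) : ℝ)
      (Sum.elim (fun _ => (polyHeight (P k) : ℝ)) fun _ => (polyHeight (P (k + 1)) : ℝ))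
  set K : ℝ := max 1 |ξ| ^ n with hK
  have hK0 : 0 ≤ K := by positivity
  have hbound : ∀ l i, k ≤ l → i ≤ n → polyHeight (P k) ≤ polyHeight (P l) →
      |aeval ξ (X ^ i * P l)| ≤ K * |aeval ξ (P k)| / polyHeight (P k) * polyHeight (P l) := by
    intro l i hl hi hle
    refine (abs_aeval_X_pow_mul_le ξ (P l) hi).trans ?_
    rw [div_mul_eq_mul_div, le_div_iff₀ hH]
    have := hP.abs_aeval_le hk hl
    gcongr
  have hbd := one_le_of_linearIndependent ξ F (by
      rw [hcard]
      have := hP.deg_le k hk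
      have := hP.deg_le (k + 1) (by omega)
      have := hP.deg_le (k + 2) (by omega)
      rintro (_ | i | i)
      · refine (natDegree_mul_le).trans_lt ?_
        rw [natDegree_X_pow]
        omega
      all_goals
        refine (natDegree_mul_le).trans_lt ?_
        rw [natDegree_X_pow]
        have := i.2
        omega) hli h (K * |aeval ξ (P k)| / polyHeight (P k)) (by
      rintro (_ | i | i)
      all_goals exact Nat.cast_le.mpr (polyHeight_X_pow_mul_le _ _)) (by
      rintro (_ | i | i)
      · exact hbound (k + 2) j (by omega) (by omega) (hP.height_le hk (by omega))
      · exact hbound k i le_rfl (by omega) le_rfl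
      · exact hbound (k + 1) i (by omega) (by omega) (hP.height_le hk (by omega)))
  rw [hcard] at hbd
  refine hbd.trans ?_
  rw [mul_assoc]
  refine mul_le_mul_of_nonneg_left ?_ (by positivity)
  simp only [h, Fintype.prod_option, Fintype.prod_sum_type, Option.elim, Sum.elim_inl,
    Sum.elim_inr, Finset.prod_const, Finset.card_univ, Fintype.card_fin]
  obtain ⟨m, rfl⟩ : ∃ m, n = m + 2 := ⟨n - 2, by omega⟩
  rw [show m + 2 - 1 = m + 1 by omega, show 2 * (m + 2) - 3 = m + (m + 1) by omega]
  calc K * |aeval ξ (P k)| / polyHeight (P k) * (polyHeight (P (k + 2)) *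
        (polyHeight (P k) ^ (m + 1) * polyHeight (P (k + 1)) ^ (m + 1)))
      = K * (|aeval ξ (P k)| * (polyHeight (P k) ^ m * polyHeight (P (k + 1)) ^ (m + 1)) *
          polyHeight (P (k + 2))) := by
        rw [pow_succ (polyHeight (P k) : ℝ) m]; field_simp
    _ ≤ K * (|aeval ξ (P k)| * (polyHeight (P (k + 1)) ^ m * polyHeight (P (k + 1)) ^ (m + 1)) *
          polyHeight (P (k + 2))) := by gcongr
    _ = _ := by rw [← pow_add]

lemma frequently_le_tauk (hP : IsBestApproxSeq n ξ P)
    (hn : 2 ≤ n) {w v : ℝ} (hw : w ∈ uniformExpSet n ξ)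
    (hw2 : 2 * (n : ℝ) - 2 < w) (hv : v < w) :
    ∃ᶠ k in atTop, v - (2 * (n : ℝ) - 3) ≤ tauk P k := by
  have hn' : (2 : ℝ) ≤ n := by exact_mod_cast hn
  obtain ⟨u, hu1, hu2⟩ := exists_between hv
  set D : ℝ := (2 * n - 1).factorial * max 1 |ξ| ^ n with hD
  have hlim := hP.tendsto_height.comp (tendsto_add_atTop_nat 1)
  have hev := hlim.eventually ((tendsto_rpow_atTop (sub_pos.mpr hu1)).eventually_ge_atTop D)
  refine (tendsto_add_atTop_nat 2).frequently ?_
  refine ((hP.frequently_not_mem_plane hn hw hw2).and_eventually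
    ((hev.and (hP.eventually_irreducible hn hw hw2)).and
      ((hP.eventually_abs_aeval_le hw hu2).and (eventually_ge_atTop 1)))).mono ?_
  rintro k ⟨hnot, ⟨hDk, hirr, hd⟩, hk1, hk⟩
  have hone := hP.one_le_mul_of_not_mem_plane hn hk
    (hP.isCoprime_of_irreducible hk (by omega) hirr hd) hd hnot
  rw [← hD] at hone
  simp only [Function.comp] at hDk
  have hgt : 1 < polyHeight (P (k + 1)) :=
    (one_le_polyHeight (hP.ne_zero k hk)).trans_lt (hP.height_lt k hk)
  have hH1 : (1 : ℝ) < polyHeight (P (k + 1)) := by exact_mod_cast hgt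
  have hH2 : (0 : ℝ) < polyHeight (P (k + 2)) := by
    exact_mod_cast one_le_polyHeight (hP.ne_zero (k + 2) (by omega))
  set H : ℝ := ((polyHeight (P (k + 1)) : ℕ) : ℝ) with hH
  have hH0 : 0 < H := by linarith
  have key : 1 ≤ H ^ (2 * (n : ℝ) - 3 - v) * polyHeight (P (k + 2)) := by
    calc (1 : ℝ) ≤ D * (|aeval ξ (P k)| * H ^ (2 * n - 3) * polyHeight (P (k + 2))) := hone
      _ ≤ H ^ (u - v) * (H ^ (-u) * H ^ (2 * n - 3) * polyHeight (P (k + 2))) := by gcongr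
      _ = _ := by
        rw [show 2 * (n : ℝ) - 3 - v = (u - v) + -u + ((2 * n - 3 : ℕ) : ℝ) by
          rw [Nat.cast_sub (by omega)]; push_cast; ring, Real.rpow_add hH0, Real.rpow_add hH0,
          Real.rpow_natCast]
        ring
  have hlog := Real.log_nonneg key
  rw [Real.log_mul (by positivity) hH2.ne', Real.log_rpow hH0] at hlog
  rw [tauk, show k + 2 - 1 = k + 1 from rfl, ← hH, le_div_iff₀ (Real.log_pos hH1)]
  linarith

end IsBestApproxSeq

/-- if `ŵ_n(ξ) > 2n-2` then `ŵ_n(ξ) ≤ limsup τ_k + 2n-3`. -/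
theorem stmt13 (n : ℕ) (hn : 2 ≤ n) (ξ : ℝ)
    (P : ℕ → Polynomial ℤ) (hP : IsBestApproxSeq n ξ P)
    (hw : ((2*(n:ℝ)-2 : ℝ) : EReal) < wHat n ξ) :
    wHat n ξ ≤ Filter.limsup (fun k => ((tauk P k : ℝ) : EReal)) Filter.atTop
      + ((2*(n:ℝ)-3 : ℝ) : EReal) := by
  have key : ∀ w ∈ uniformExpSet n ξ, 2 * (n : ℝ) - 2 < w →
      (w : EReal) ≤ limsup (fun k => ((tauk P k : ℝ) : EReal)) atTop
        + ((2 * (n : ℝ) - 3 : ℝ) : EReal) := by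
    intro w hw hw2
    refine EReal.ge_of_forall_gt_iff_ge.mp fun v hv => ?_
    have hfreq := hP.frequently_le_tauk hn hw hw2 (EReal.coe_lt_coe_iff.mp hv)
    have hlim : ((v - (2 * (n : ℝ) - 3) : ℝ) : EReal) ≤
        limsup (fun k => ((tauk P k : ℝ) : EReal)) atTop :=
      le_limsup_of_frequently_le' (hfreq.mono fun k hk => EReal.coe_le_coe_iff.mpr hk)
    calc (v : EReal) = ((v - (2 * (n : ℝ) - 3) : ℝ) : EReal) + ((2 * (n : ℝ) - 3 : ℝ) : EReal) := by
          rw [← EReal.coe_add, sub_add_cancel]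
      _ ≤ _ := by gcongr
  obtain ⟨_, ⟨w₀, hw₀, rfl⟩, hlt⟩ := lt_sSup_iff.mp hw
  refine sSup_le ?_
  rintro _ ⟨w, hw, rfl⟩
  rcases lt_or_ge (2 * (n : ℝ) - 2) w with h | h
  · exact key w hw h
  · exact (EReal.coe_le_coe_iff.mpr h).trans
      (hlt.le.trans (key w₀ hw₀ (EReal.coe_lt_coe_iff.mp hlt)))
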